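/- arXiv:2504.08023 — 8 statements merged into one kernel-verified Lean document; each statement's English description precedes it below -/
import Mathlib

section
/- Let n be a positive integer satisfying φ(n) + φ(n + φ(n)) = n. Then there exists an integer ℓ ≥ 1 such that either n = 2^ℓ · c for some c ∈ {1, 3, 5, 7, 35, 47}, or there exists a natural number m such that 8m+7 is a prime with 8m+7 ≥ 10^10, φ(6m+5) = 4m+4, and n = 2^ℓ·(8m+7) or n = 2^ℓ·(6m+5). -/
/-- A cheap necessary condition for primality: trial division by the primes up to `23`. -/
def maybePrime (p : ℕ) : Bool :=
  (Nat.ble p 3 || Nat.beq (Nat.gcd p 6) 1) &&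
    (Nat.ble p 23 || Nat.beq (Nat.gcd p 25852016738884976640000) 1)

/-- `N` is `5`, `35`, or `(4 * N + 1) / 3` is visibly composite. -/
def admissible (N : ℕ) : Bool :=
  Nat.beq N 5 || (Nat.beq N 35 || !maybePrime ((4 * N + 1) / 3))

/-- Test the only possible last prime factor `q = (3 * B + 2) / (3 * B - 2 * A)` of `A * q`. -/
def checkLast (A B : ℕ) : Bool :=
  !Nat.beq ((3 * B + 2) % (3 * B - 2 * A)) 0 ||
    (!maybePrime ((3 * B + 2) / (3 * B - 2 * A)) ||
      admissible (A * ((3 * B + 2) / (3 * B - 2 * A))))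

/-- Run through the candidates `p, p + 1, …` for the least of `t` remaining prime factors,
calling `f` on each one. -/
def searchLoop (bound : ℕ) (f : ℕ → ℕ → ℕ → Bool) (t A B : ℕ) : ℕ → ℕ → Bool
  | 0, _ => false
  | fuel + 1, p =>
    Nat.blt bound (A * p ^ t) || (Nat.blt (2 * A * p ^ t + 2) (3 * B * (p - 1) ^ t) ||
      ((!(maybePrime p && Nat.ble (Nat.gcd (p - 1) A) 2) || f (A * p) (B * (p - 1)) (p + 1)) &&
        searchLoop bound f t A B fuel (p + 1)))

/-- Search for the squarefree `N = A * R ≤ bound` with `3 * φ N = 2 * (N + 1)`, where `B = φ A`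
and `R` has exactly `t` prime factors, all of them at least `L`. -/
def search (bound : ℕ) : ℕ → ℕ → ℕ → ℕ → Bool
  | 0, _, _, _ => true
  | 1, A, B, _ => Nat.ble (3 * B) (2 * A) || checkLast A B
  | t + 2, A, B, L => Nat.ble (3 * B) (2 * A) ||
      searchLoop bound (search bound (t + 1)) (t + 2) A B 100000
        (max L (3 * B / (3 * B - 2 * A) + 1))

/-- `l` is an increasing list of primes, all at least `L`, whose product `R` satisfies
`3 * B * φ R = 2 * (A * R + 1)` and `A * R ≤ bound`. -/
structure IsCompletion (bound A B L : ℕ) (l : List ℕ) : Prop where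
  prime : ∀ q ∈ l, q.Prime
  ge : ∀ q ∈ l, L ≤ q
  sorted : l.Pairwise (· < ·)
  eqn : 3 * B * (l.map (· - 1)).prod = 2 * (A * l.prod + 1)
  le : A * l.prod ≤ bound

theorem maybePrime_of_prime {p : ℕ} (hp : p.Prime) : maybePrime p = true := by
  have key : ∀ k, p ≤ k ∨ Nat.gcd p k.factorial = 1 := fun k => by
    rcases le_or_gt p k with h | h
    · exact Or.inl h
    · exact Or.inr ((Nat.Prime.coprime_iff_not_dvd hp).2 fun hd =>
        absurd (hp.dvd_factorial.1 hd) (by omega))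
  have h3 := key 3
  have h23 := key 23
  rw [show Nat.factorial 3 = 6 by decide] at h3
  rw [show Nat.factorial 23 = 25852016738884976640000 by decide +kernel] at h23
  simp [maybePrime, h3, h23]

theorem admissible_spec {N : ℕ} (h : admissible N = true) (hp : ((4 * N + 1) / 3).Prime) :
    N = 5 ∨ N = 35 := by
  simpa [admissible, maybePrime_of_prime hp] using h

theorem checkLast_spec {A B q : ℕ} (h : checkLast A B = true) (hlt : 2 * A < 3 * B)
    (hq : q.Prime) (heq : 3 * B * (q - 1) = 2 * (A * q + 1)) : admissible (A * q) = true := by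
  obtain ⟨D, hD⟩ : ∃ D, 3 * B = 2 * A + D := ⟨3 * B - 2 * A, by omega⟩
  obtain ⟨r, rfl⟩ : ∃ r, q = r + 1 := ⟨q - 1, by have := hq.pos; omega⟩
  have hmul : 3 * B + 2 = D * (r + 1) := by
    simp only [Nat.add_sub_cancel] at heq
    rw [hD] at heq ⊢
    nlinarith
  have hsub : 3 * B - 2 * A = D := by omega
  have hDpos : 0 < D := by omega
  simpa [checkLast, hsub, hmul, Nat.mul_div_cancel_left _ hDpos, maybePrime_of_prime hq] using h

theorem prod_bounds {p : ℕ} (hp : 0 < p) (l : List ℕ) (hl : ∀ q ∈ l, p ≤ q) :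
    p ^ l.length ≤ l.prod ∧
      l.prod * (p - 1) ^ l.length ≤ (l.map (· - 1)).prod * p ^ l.length ∧
      (l.map (· - 1)).prod ≤ l.prod := by
  induction l with
  | nil => simp
  | cons q l ih =>
    obtain ⟨h1, h2, h3⟩ := ih fun x hx => hl x (by simp [hx])
    have hq := hl q (by simp)
    obtain ⟨r, rfl⟩ : ∃ r, p = r + 1 := ⟨p - 1, by omega⟩
    obtain ⟨s, rfl⟩ : ∃ s, q = s + 1 := ⟨q - 1, by omega⟩
    simp only [List.length_cons, List.prod_cons, List.map_cons, Nat.add_sub_cancel] at *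
    refine ⟨?_, ?_, Nat.mul_le_mul (by omega) h3⟩
    · rw [pow_succ, mul_comm]
      exact Nat.mul_le_mul hq h1
    · have h4 : (s + 1) * r ≤ s * (r + 1) := by nlinarith
      calc (s + 1) * l.prod * r ^ (l.length + 1)
          = ((s + 1) * r) * (l.prod * r ^ l.length) := by ring
        _ ≤ (s * (r + 1)) * ((l.map (· - 1)).prod * (r + 1) ^ l.length) := Nat.mul_le_mul h4 h2
        _ = _ := by ring

namespace IsCompletion

variable {bound A B L : ℕ} {l : List ℕ}

theorem pow_le (h : IsCompletion bound A B L l) (hL : 0 < L) : A * L ^ l.length ≤ bound :=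
  (Nat.mul_le_mul_left A (prod_bounds hL l h.ge).1).trans h.le

theorem ratio_le (h : IsCompletion bound A B L l) (hL : 0 < L) :
    3 * B * (L - 1) ^ l.length ≤ 2 * A * L ^ l.length + 2 := by
  obtain ⟨h1, h2, -⟩ := prod_bounds hL l h.ge
  have heq := h.eqn
  by_contra! hlt
  have hpos : 0 < l.prod := lt_of_lt_of_le (by positivity) h1
  have h3 := Nat.mul_le_mul_left (3 * B) h2
  have h4 : 3 * B * ((l.map (· - 1)).prod * L ^ l.length)
      = 2 * (A * l.prod + 1) * L ^ l.length := by rw [← heq]; ring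
  have h5 := Nat.mul_le_mul_left l.prod (Nat.succ_le_of_lt hlt)
  rw [h4] at h3
  simp only [Nat.succ_eq_add_one] at h5
  nlinarith

theorem gcd_le (h : IsCompletion bound A B L l) {q : ℕ} (hq : q ∈ l) :
    Nat.gcd (q - 1) A ≤ 2 := by
  refine Nat.le_of_dvd two_pos ?_
  have h1 : Nat.gcd (q - 1) A ∣ 2 * (A * l.prod + 1) := by
    rw [← h.eqn]
    exact ((Nat.gcd_dvd_left _ _).trans
      (List.dvd_prod (List.mem_map_of_mem (f := (· - 1)) hq))).mul_left _
  have h2 : Nat.gcd (q - 1) A ∣ 2 * (A * l.prod) :=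
    ((Nat.gcd_dvd_right _ _).mul_right _).mul_left _
  rw [mul_add] at h1
  simpa using (Nat.dvd_add_right h2).1 h1

theorem two_mul_lt (h : IsCompletion bound A B L l) : 2 * A < 3 * B := by
  have h1 := (prod_bounds (p := 1) one_pos l fun q hq => (h.prime q hq).pos).2.2
  have h2 := h.eqn
  by_contra! hle
  have h3 := Nat.mul_le_mul hle h1
  rw [h2] at h3
  nlinarith

theorem tail {q : ℕ} (h : IsCompletion bound A B L (q :: l)) :
    IsCompletion bound (A * q) (B * (q - 1)) (q + 1) l where
  prime x hx := h.prime x (by simp [hx])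
  ge := (List.pairwise_cons.1 h.sorted).1
  sorted := (List.pairwise_cons.1 h.sorted).2
  eqn := by
    have := h.eqn
    simp only [List.map_cons, List.prod_cons] at this
    rw [mul_assoc A, ← this]
    ring
  le := by simpa [mul_assoc] using h.le

theorem div_lt_head {q : ℕ} (h : IsCompletion bound A B L (q :: l)) :
    3 * B / (3 * B - 2 * A) < q := by
  have hlt := h.tail.two_mul_lt
  have hlt' := h.two_mul_lt
  obtain ⟨D, hD⟩ : ∃ D, 3 * B = 2 * A + D := ⟨3 * B - 2 * A, by omega⟩
  have hq := (h.prime q (by simp)).pos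
  obtain ⟨r, rfl⟩ : ∃ r, q = r + 1 := ⟨q - 1, by omega⟩
  rw [show 3 * B - 2 * A = D by omega, Nat.div_lt_iff_lt_mul (by omega)]
  simp only [Nat.add_sub_cancel] at hlt
  rw [← mul_assoc 3, hD] at hlt
  rw [hD]
  nlinarith

theorem mono {L' : ℕ} {q : ℕ} (h : IsCompletion bound A B L (q :: l)) (hL : L' ≤ q) :
    IsCompletion bound A B L' (q :: l) where
  prime := h.prime
  ge x hx := by
    rcases List.mem_cons.1 hx with rfl | hx
    · exact hL
    · exact hL.trans ((List.pairwise_cons.1 h.sorted).1 x hx).le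
  sorted := h.sorted
  eqn := h.eqn
  le := h.le

end IsCompletion

theorem searchLoop_spec {bound : ℕ} {f : ℕ → ℕ → ℕ → Bool} {t A B : ℕ}
    (hf : ∀ A B L l, f A B L = true → 0 < L → IsCompletion bound A B L l → l.length = t →
      admissible (A * l.prod) = true) (fuel p : ℕ) (hp : 0 < p)
    (hs : searchLoop bound f (t + 1) A B fuel p = true) (q : ℕ) (l : List ℕ)
    (hc : IsCompletion bound A B p (q :: l)) (hl : l.length = t) :
    admissible (A * (q * l.prod)) = true := by
  induction fuel generalizing p with
  | zero => simp [searchLoop] at hs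
  | succ fuel ih =>
    have h1 := hc.pow_le hp
    have h2 := hc.ratio_le hp
    rw [List.length_cons, hl] at h1 h2
    simp only [searchLoop, Bool.or_eq_true, Bool.and_eq_true, Nat.blt_eq] at hs
    rcases hs with hs | hs | ⟨hs, hrec⟩
    · omega
    · omega
    · rcases (hc.ge q (by simp)).eq_or_lt with rfl | hlt
      · have hg := Nat.ble_eq_true_of_le (hc.gcd_le (q := p) (by simp))
        have hf' : f (A * p) (B * (p - 1)) (p + 1) = true := by
          simpa [maybePrime_of_prime (hc.prime p (by simp)), hg] using hs
        rw [← mul_assoc]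
        exact hf _ _ _ _ hf' (by omega) hc.tail hl
      · exact ih (p + 1) (by omega) hrec (hc.mono hlt)

theorem search_spec {bound : ℕ} (t A B L : ℕ) (l : List ℕ)
    (hs : search bound (t + 1) A B L = true) (hL : 0 < L) (hc : IsCompletion bound A B L l)
    (hl : l.length = t + 1) : admissible (A * l.prod) = true := by
  induction t generalizing A B L l with
  | zero =>
    obtain ⟨q, rfl⟩ := List.length_eq_one_iff.1 hl
    have hlt := hc.two_mul_lt
    simp only [search, Bool.or_eq_true, Nat.ble_eq] at hs
    simpa using checkLast_spec (hs.resolve_left (by omega)) hlt (hc.prime q (by simp))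
      (by simpa using hc.eqn)
  | succ t ih =>
    obtain ⟨q, l, rfl⟩ := List.exists_cons_of_length_eq_add_one hl
    have hlt := hc.two_mul_lt
    simp only [search, Bool.or_eq_true, Nat.ble_eq] at hs
    rw [List.prod_cons]
    exact searchLoop_spec (t := t + 1) (fun A B L l h1 h2 h3 h4 => ih A B L l h1 h2 h3 h4)
      _ _ (by omega) (hs.resolve_left (by omega)) q l
      (hc.mono (max_le (hc.ge q (by simp)) hc.div_lt_head)) (by simpa using hl)

theorem search_eq_true : ∀ t < 14, search 7500000000 (t + 1) 1 1 5 = true := by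
  decide +kernel

theorem totient_list_prod (l : List ℕ) (hp : ∀ q ∈ l, q.Prime) (hs : l.Pairwise (· < ·)) :
    Nat.totient l.prod = (l.map (· - 1)).prod := by
  induction l with
  | nil => simp
  | cons q l ih =>
    rw [List.pairwise_cons] at hs
    have hcop : Nat.Coprime q l.prod := Nat.coprime_list_prod_right_iff.2 fun x hx =>
      (Nat.coprime_primes (hp q (by simp)) (hp x (by simp [hx]))).2 (hs.1 x hx).ne
    rw [List.prod_cons, List.map_cons, List.prod_cons, Nat.totient_mul hcop,
      Nat.totient_prime (hp q (by simp)), ih (fun x hx => hp x (by simp [hx])) hs.2]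

theorem squarefree_of_three_mul_totient {N : ℕ} (hodd : Odd N)
    (h : 3 * Nat.totient N = 2 * (N + 1)) : Squarefree N := by
  rw [Nat.squarefree_iff_prime_squarefree]
  rintro p hp ⟨c, rfl⟩
  have h1 : p ∣ Nat.totient (p * p * c) := by
    rw [mul_assoc, Nat.totient_mul_of_prime_of_dvd hp (Dvd.intro _ rfl)]
    exact Dvd.intro _ rfl
  have h2 : p ∣ 2 * (p * p * c) + 2 := by
    rw [← mul_add_one, ← h]
    exact h1.mul_left 3
  have h3 : p ∣ 2 := (Nat.dvd_add_right ⟨2 * (p * c), by ring⟩).1 h2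
  rw [(Nat.prime_dvd_prime_iff_eq hp Nat.prime_two).1 h3] at hodd
  exact absurd hodd (Nat.not_odd_iff_even.2 ⟨2 * c, by ring⟩)

theorem eq_zero_or_five_of_prime_lt {m : ℕ} (hp : (8 * m + 7).Prime) (hlt : 8 * m + 7 < 10 ^ 10)
    (hφ : Nat.totient (6 * m + 5) = 4 * m + 4) : m = 0 ∨ m = 5 := by
  have hsq : Squarefree (6 * m + 5) :=
    squarefree_of_three_mul_totient ⟨3 * m + 2, by ring⟩ (by omega)
  have hprod := Nat.prod_primeFactorsList (n := 6 * m + 5) (by omega)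
  set l := (6 * m + 5).primeFactorsList with hl
  have hprime : ∀ q ∈ l, q.Prime := fun q hq => Nat.prime_of_mem_primeFactorsList hq
  have hsorted : l.Pairwise (· < ·) := by
    have h1 : l.Pairwise (· ≤ ·) := (Nat.primeFactorsList_sorted _).pairwise
    have h2 : l.Nodup := (Nat.squarefree_iff_nodup_primeFactorsList (by omega)).1 hsq
    exact (h1.and h2).imp fun h => lt_of_le_of_ne h.1 h.2
  have hge : ∀ q ∈ l, 5 ≤ q := fun q hq => by
    have hd : q ∣ 6 * m + 5 := Nat.dvd_of_mem_primeFactorsList hq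
    have hq2 := (hprime q hq).two_le
    by_contra! hlt5
    interval_cases q <;> omega
  have hc : IsCompletion 7500000000 1 1 5 l := by
    refine ⟨hprime, hge, hsorted, ?_, by omega⟩
    rw [← totient_list_prod l hprime hsorted, hprod, hφ]
    ring
  have hlen : l.length ≠ 0 := fun h0 => by
    rw [List.length_eq_zero_iff.1 h0] at hprod
    simp at hprod
  have hlen' : l.length < 15 := by
    by_contra! h15
    have h1 := hc.pow_le (by norm_num)
    have h2 : 5 ^ 15 ≤ 5 ^ l.length := Nat.pow_le_pow_right (by norm_num) h15
    norm_num at h2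
    omega
  have hadm := search_spec (l.length - 1) 1 1 5 l (search_eq_true _ (by omega)) (by norm_num) hc
    (by omega)
  rw [one_mul, hprod] at hadm
  have hdiv : (4 * (6 * m + 5) + 1) / 3 = 8 * m + 7 := by omega
  have := admissible_spec hadm (by rwa [hdiv])
  omega

theorem exists_eq_prime_pow_of_not_four_dvd_totient {a : ℕ} (hodd : Odd a) (ha : 1 < a)
    (h4 : ¬ 4 ∣ Nat.totient a) : ∃ p j, p.Prime ∧ a = p ^ (j + 1) := by
  have hp : a.minFac.Prime := Nat.minFac_prime (by omega)
  have hpa : a.minFac ∣ a := Nat.minFac_dvd a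
  obtain ⟨k, c, hc, hac⟩ := Nat.exists_eq_pow_mul_and_not_dvd (by omega : a ≠ 0) a.minFac hp.ne_one
  generalize a.minFac = p at *
  have hk : k ≠ 0 := fun h0 => hc (by simpa [hac, h0] using hpa)
  obtain ⟨j, rfl⟩ := Nat.exists_eq_succ_of_ne_zero hk
  refine ⟨p, j, hp, ?_⟩
  have hoc : Odd c ∧ Odd (p ^ (j + 1)) := by
    rw [hac, Nat.odd_mul] at hodd
    exact hodd.symm
  by_contra hne
  have hc1 : c ≠ 1 := fun h1 => hne (by simpa [h1] using hac)
  have hcop : Nat.Coprime (p ^ (j + 1)) c :=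
    Nat.Coprime.pow_left _ ((Nat.Prime.coprime_iff_not_dvd hp).2 hc)
  have hpow : p ^ (j + 1) ≠ 1 := (Nat.one_lt_pow (by omega) hp.one_lt).ne'
  have hev : ∀ x, Odd x → x ≠ 1 → 2 ∣ Nat.totient x := fun x hx hx1 =>
    (Nat.totient_even (by obtain ⟨r, rfl⟩ := hx; omega)).two_dvd
  rw [hac, Nat.totient_mul hcop] at h4
  exact h4 (mul_dvd_mul (hev _ hoc.2 hpow) (hev _ hoc.1 hc1))

theorem totient_two_pow_mul (s M : ℕ) :
    Nat.totient (2 ^ s * (2 * M)) = 2 ^ s * Nat.totient (2 * M) := by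
  induction s with
  | zero => simp
  | succ s ih =>
    rw [pow_succ', mul_assoc,
      Nat.totient_mul_of_prime_of_dvd Nat.prime_two ⟨2 ^ s * M, by ring⟩, ih, mul_assoc]

theorem totient_two_mul_of_odd {M : ℕ} (hM : Odd M) :
    Nat.totient (2 * M) = Nat.totient M := by
  rw [Nat.totient_mul hM.coprime_two_left]
  simp

/-- The equation `2 * φ(p ^ j * Q) = p ^ j * (p + 1)` with `Q = (3 * p - 1) / 2` even. -/
theorem totient_prime_pow_mul_eq {p j Q : ℕ} (hp : p.Prime) (hp2 : Odd p) (hQ : 2 * Q + 1 = 3 * p)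
    (hQe : Even Q) (h : 2 * Nat.totient (p ^ j * Q) = p ^ j * (p + 1)) :
    j = 0 ∧ (p = 3 ∨ ∃ m, p = 8 * m + 7 ∧ Nat.totient (6 * m + 5) = 4 * m + 4) := by
  have hj : j = 0 := by
    by_contra hj
    obtain ⟨i, rfl⟩ := Nat.exists_eq_succ_of_ne_zero hj
    have hcop : Nat.Coprime p Q := (Nat.Prime.coprime_iff_not_dvd hp).2 fun hd =>
      hp.one_lt.ne' (Nat.dvd_one.1 ((Nat.dvd_add_right (hd.mul_left 2)).1 ⟨3, by omega⟩))
    rw [Nat.totient_mul (hcop.pow_left _), Nat.totient_prime_pow_succ hp] at h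
    obtain ⟨r, rfl⟩ : ∃ r, p = r + 1 := ⟨p - 1, by have := hp.pos; omega⟩
    simp only [Nat.succ_eq_add_one, Nat.add_sub_cancel] at h
    have h1 : 2 * (r * Nat.totient Q) = (r + 1) * (r + 1 + 1) := by
      have : 0 < (r + 1) ^ i := by positivity
      apply Nat.eq_of_mul_eq_mul_left this
      rw [pow_succ] at h
      linarith
    have h2 : r ∣ 2 := (Nat.dvd_add_right (Dvd.intro (r + 3) rfl : r ∣ r * (r + 3))).1
      ⟨2 * Nat.totient Q, by linarith⟩
    have h3 : r ≤ 2 := Nat.le_of_dvd two_pos h2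
    obtain ⟨c, hc⟩ := hp2
    have h4 : r = 2 := by have := hp.two_le; omega
    subst h4
    have hQ4 : Q = 4 := by omega
    subst hQ4
    rw [show Nat.totient 4 = 2 by decide] at h1
    omega
  refine ⟨hj, ?_⟩
  subst hj
  rw [pow_zero, one_mul, one_mul] at h
  obtain ⟨c, hc⟩ := hQe
  obtain ⟨m, hm | hm⟩ : ∃ m, p = 8 * m + 7 ∨ p = 8 * m + 3 := ⟨p / 8, by omega⟩
  · refine Or.inr ⟨m, hm, ?_⟩
    have hQm : Q = 2 * (6 * m + 5) := by omega
    rw [hQm, totient_two_mul_of_odd ⟨3 * m + 2, by ring⟩] at h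
    omega
  · left
    by_contra hne
    have hQm : Q = 2 * (2 * (3 * m + 1)) := by omega
    rw [hQm, Nat.totient_mul_of_prime_of_dvd Nat.prime_two (Dvd.intro _ rfl)] at h
    obtain ⟨d, hd⟩ := Nat.totient_even (n := 2 * (3 * m + 1)) (by omega)
    omega

theorem exists_of_totient_add_eq {a b : ℕ} (hodd : Odd a) (ha : 1 < a)
    (hφ : Nat.totient a = 2 * b) (h : Nat.totient (2 * (a + b)) + 2 * b = 2 * a) :
    a = 3 ∨ ∃ m, (8 * m + 7).Prime ∧ Nat.totient (6 * m + 5) = 4 * m + 4 ∧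
      (a = 8 * m + 7 ∨ a = 6 * m + 5) := by
  have hodd' := hodd
  obtain ⟨d, hd⟩ := hodd'
  rcases Nat.even_or_odd (a + b) with hM | hM
  · have hM' := hM
    obtain ⟨e, he⟩ := hM'
    rw [Nat.totient_mul_of_prime_of_dvd Nat.prime_two hM.two_dvd] at h
    obtain ⟨p, j, hp, rfl⟩ := exists_eq_prime_pow_of_not_four_dvd_totient hodd ha (by omega)
    have hpo : Odd p := (Nat.odd_pow_iff (by omega)).1 hodd
    rw [Nat.totient_prime_pow_succ hp] at hφ
    obtain ⟨r, rfl⟩ := hpo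
    have hb : b = (2 * r + 1) ^ j * r := by
      have : (2 * r + 1) ^ j * (2 * r) = 2 * ((2 * r + 1) ^ j * r) := by ring
      simp only [Nat.add_sub_cancel] at hφ
      omega
    have hsum : (2 * r + 1) ^ (j + 1) + b = (2 * r + 1) ^ j * (3 * r + 1) := by rw [hb]; ring
    have hQe : Even (3 * r + 1) := by
      rw [hsum, Nat.even_mul] at hM
      exact hM.resolve_left (Nat.not_even_iff_odd.2 (Odd.pow ⟨r, rfl⟩))
    rw [hsum, hb, pow_succ] at h
    obtain ⟨rfl, hres⟩ := totient_prime_pow_mul_eq (j := j) (Q := 3 * r + 1) hp ⟨r, rfl⟩ (by ring)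
      hQe (by linarith)
    rw [zero_add, pow_one]
    exact hres.imp_right fun ⟨m, hm, hm'⟩ => ⟨m, hm ▸ hp, hm', Or.inl hm⟩
  · have hM' := hM
    obtain ⟨e, he⟩ := hM'
    rw [totient_two_mul_of_odd hM] at h
    obtain ⟨q, j, hq, hMq⟩ := exists_eq_prime_pow_of_not_four_dvd_totient hM (by omega) (by omega)
    have hqo : Odd q := (Nat.odd_pow_iff (by omega)).1 (hMq ▸ hM)
    rw [hMq, Nat.totient_prime_pow_succ hq] at h
    obtain ⟨r, rfl⟩ := hqo
    simp only [Nat.add_sub_cancel] at h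
    rw [pow_succ] at hMq
    have h2a : 2 * a = (2 * r + 1) ^ j * (3 * r + 1) := by linarith
    have h2b : 2 * b = (2 * r + 1) ^ j * (r + 1) := by linarith
    have hQe : Even (3 * r + 1) := by
      have : Even (2 * a) := even_two_mul a
      rw [h2a, Nat.even_mul] at this
      exact this.resolve_left (Nat.not_even_iff_odd.2 (Odd.pow ⟨r, rfl⟩))
    rw [← totient_two_mul_of_odd hodd, h2a] at hφ
    obtain ⟨rfl, hres⟩ := totient_prime_pow_mul_eq (j := j) (Q := 3 * r + 1) hq ⟨r, rfl⟩ (by ring)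
      hQe (by linarith)
    rw [pow_zero, one_mul] at h2a
    rcases hres with h3 | ⟨m, hm, hm'⟩
    · omega
    · exact Or.inr ⟨m, hm ▸ hq, hm', Or.inr (by omega)⟩

theorem stmt_0 (n : ℕ) (hn : 0 < n)
    (h : Nat.totient n + Nat.totient (n + Nat.totient n) = n) :
    ∃ ℓ : ℕ, 1 ≤ ℓ ∧
      ((∃ c ∈ ({1, 3, 5, 7, 35, 47} : Finset ℕ), n = 2 ^ ℓ * c) ∨
        ∃ m : ℕ, Nat.Prime (8 * m + 7) ∧ 8 * m + 7 ≥ 10 ^ 10 ∧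
          Nat.totient (6 * m + 5) = 4 * m + 4 ∧
          (n = 2 ^ ℓ * (8 * m + 7) ∨ n = 2 ^ ℓ * (6 * m + 5))) := by
  obtain ⟨ℓ, a, ha, rfl⟩ := Nat.exists_eq_two_pow_mul_odd hn.ne'
  obtain rfl | ⟨s, rfl⟩ : ℓ = 0 ∨ ∃ s, ℓ = s + 1 := by cases ℓ <;> simp
  · rw [pow_zero, one_mul] at h
    obtain ⟨d, rfl⟩ := ha
    rcases Nat.eq_zero_or_pos d with rfl | hd
    · simp at h
    · obtain ⟨x, hx⟩ := Nat.totient_even (n := 2 * d + 1) (by omega)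
      obtain ⟨y, hy⟩ := Nat.totient_even
        (n := 2 * d + 1 + Nat.totient (2 * d + 1)) (by omega)
      omega
  refine ⟨s + 1, by omega, ?_⟩
  rcases (Nat.succ_le_of_lt ha.pos).eq_or_lt with h1 | h1
  · exact Or.inl ⟨1, by simp, by rw [← h1]⟩
  obtain ⟨b, hb⟩ := (Nat.totient_even (n := a) (by obtain ⟨d, rfl⟩ := ha; omega)).two_dvd
  have hφn : Nat.totient (2 ^ (s + 1) * a) = 2 ^ s * (2 * b) := by
    rw [pow_succ, mul_assoc, totient_two_pow_mul, totient_two_mul_of_odd ha, hb]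
  have hsum : 2 ^ (s + 1) * a + 2 ^ s * (2 * b) = 2 ^ s * (2 * (a + b)) := by ring
  rw [hφn, hsum, totient_two_pow_mul, pow_succ, mul_assoc, ← mul_add] at h
  have h' := Nat.eq_of_mul_eq_mul_left (by positivity) h
  rcases exists_of_totient_add_eq ha h1 hb (by omega) with rfl | ⟨m, hp, hφ, hm⟩
  · exact Or.inl ⟨3, by simp, rfl⟩
  rcases le_or_gt (10 ^ 10) (8 * m + 7) with hge | hlt
  · exact Or.inr ⟨m, hp, hge, hφ, hm.imp (fun h => by rw [h]) fun h => by rw [h]⟩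
  · refine Or.inl ⟨a, ?_, rfl⟩
    rcases eq_zero_or_five_of_prime_lt hp hlt hφ with rfl | rfl <;>
      rcases hm with rfl | rfl <;> simp
end

section
/- Let m be an even positive integer satisfying φ(m) + φ(m + φ(m)) = m. Then for every k ≥ 0 one has g_{k+2}(m) = 2·g_k(m). In particular, if g_{k+2}(n) = 2·g_k(n) holds for some k, then g_{j+2}(n) = 2·g_j(n) holds for every j ≥ k. -/
def g (n : ℕ) : ℕ := n + Nat.totient n

theorem g_two_mul_of_even {x : ℕ} (hx : Even x) : g (2 * x) = 2 * g x := by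
  rw [g, g, Nat.totient_mul_of_prime_of_dvd Nat.prime_two hx.two_dvd, mul_add]

theorem even_g {x : ℕ} (h2 : 2 < x) (hx : Even x) : Even (g x) :=
  hx.add (Nat.totient_even h2)

theorem two_lt_and_even_iterate_g {m : ℕ} (h2 : 2 < m) (hm : Even m) (k : ℕ) :
    2 < g^[k] m ∧ Even (g^[k] m) := by
  induction k with
  | zero => exact ⟨h2, hm⟩
  | succ k ih =>
    rw [Function.iterate_succ_apply']
    exact ⟨ih.1.trans_le (Nat.le_add_right _ _), even_g ih.1 ih.2⟩

theorem two_lt_and_even_of_g_g_eq {m : ℕ} (h0 : 0 < m) (h : g (g m) = 2 * m) :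
    2 < m ∧ Even m := by
  have h2 : 2 < m := by
    by_contra! hm
    interval_cases m <;> revert h <;> decide
  refine ⟨h2, ?_⟩
  have h1 := Nat.totient_even h2
  have h3 : Even (Nat.totient (m + Nat.totient m)) := Nat.totient_even (by omega)
  have h4 : m = Nat.totient m + Nat.totient (m + Nat.totient m) := by
    simp only [g] at h
    omega
  rw [h4]
  exact h1.add h3

theorem iterate_g_add_two {m : ℕ} (h0 : 0 < m) (h : g (g m) = 2 * m) (k : ℕ) :
    g^[k + 2] m = 2 * g^[k] m := by
  obtain ⟨h2, hm⟩ := two_lt_and_even_of_g_g_eq h0 h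
  induction k with
  | zero => exact h
  | succ k ih =>
    rw [show k + 1 + 2 = k + 2 + 1 from rfl, Function.iterate_succ_apply', ih,
      g_two_mul_of_even (two_lt_and_even_iterate_g h2 hm k).2, Function.iterate_succ_apply']

theorem iterate_g_pos {n : ℕ} (hn : 0 < n) (k : ℕ) : 0 < g^[k] n := by
  induction k with
  | zero => exact hn
  | succ k ih =>
    rw [Function.iterate_succ_apply']
    exact Nat.add_pos_left ih _

theorem stmt_3 :
    (∀ m : ℕ, 0 < m → Even m →
      Nat.totient m + Nat.totient (m + Nat.totient m) = m →
      ∀ k : ℕ, g^[k + 2] m = 2 * g^[k] m) ∧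
    (∀ n k : ℕ, 0 < n → g^[k + 2] n = 2 * g^[k] n →
      ∀ j : ℕ, k ≤ j → g^[j + 2] n = 2 * g^[j] n) := by
  refine ⟨fun m h0 _ h => iterate_g_add_two h0 ?_, fun n k hn h j hj => ?_⟩
  · simp only [g]
    omega
  · obtain ⟨i, rfl⟩ := Nat.exists_eq_add_of_le' hj
    rw [Function.iterate_succ_apply', Function.iterate_succ_apply'] at h
    have := iterate_g_add_two (iterate_g_pos hn k) h i
    rwa [← Function.iterate_add_apply, ← Function.iterate_add_apply, add_right_comm] at this
end

section
/- Every integer m ≥ 3 satisfying φ(m) + φ(m + φ(m)) = m is even. (Moreover, m = 1 and m = 2 are not solutions of this equation.) -/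
theorem stmt_4 :
    (∀ m : ℕ, 3 ≤ m → Nat.totient m + Nat.totient (m + Nat.totient m) = m → Even m) ∧
    ¬(Nat.totient 1 + Nat.totient (1 + Nat.totient 1) = 1) ∧
    ¬(Nat.totient 2 + Nat.totient (2 + Nat.totient 2) = 2) := by
  refine ⟨fun m hm h => ?_, by decide, by decide⟩
  rw [← h]
  exact (Nat.totient_even (by omega)).add (Nat.totient_even (by omega))
end

section
/- Let n = 2^ℓ·q with ℓ ≥ 1 and q > 1 odd. Then the 2-adic valuation of φ(n) is at least the 2-adic valuation of n (which equals ℓ), with equality if and only if q = p^α for some prime p with p ≡ 3 (mod 4) and some integer α ≥ 1. -/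
/-- A nonzero natural number has 2-adic valuation one iff it is congruent to 2 modulo 4. -/
lemma padicValNat_two_eq_one_iff {m : ℕ} (hm : m ≠ 0) : padicValNat 2 m = 1 ↔ m % 4 = 2 := by
  have h1 := padicValNat_dvd_iff_le (p := 2) (n := 1) hm
  have h2 := padicValNat_dvd_iff_le (p := 2) (n := 2) hm
  norm_num at h1 h2
  omega

lemma one_le_padicValNat_two_totient {m : ℕ} (hm : 2 < m) : 1 ≤ padicValNat 2 m.totient :=
  one_le_padicValNat_of_dvd (Nat.totient_pos.2 (by omega)).ne' (Nat.totient_even hm).two_dvd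

lemma padicValNat_two_totient_prime_pow_eq_one_iff {p k : ℕ} (hp : p.Prime) (hodd : Odd p)
    (hk : 1 ≤ k) : padicValNat 2 (p ^ k).totient = 1 ↔ p % 4 = 3 := by
  have h1 := hp.one_lt
  have hv : padicValNat 2 (p ^ (k - 1)) = 0 :=
    padicValNat.eq_zero_of_not_dvd hodd.pow.not_two_dvd_nat
  rw [Nat.totient_prime_pow hp hk,
    padicValNat.mul (pow_ne_zero _ hp.ne_zero) (by omega), hv, zero_add,
    padicValNat_two_eq_one_iff (by omega)]
  omega

lemma padicValNat_two_totient_eq_one_iff {q : ℕ} (hq1 : 1 < q) (hq : Odd q) :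
    padicValNat 2 q.totient = 1 ↔ ∃ p k : ℕ, p.Prime ∧ p % 4 = 3 ∧ 1 ≤ k ∧ q = p ^ k := by
  constructor
  · intro h
    obtain ⟨p, hp, hpq⟩ := Nat.exists_prime_and_dvd hq1.ne'
    have hpo : Odd p := hq.of_dvd_nat hpq
    obtain ⟨k, m, hm, rfl⟩ := Nat.exists_eq_pow_mul_and_not_dvd (by omega : q ≠ 0) p hp.ne_one
    have hk : 1 ≤ k := by
      by_contra! hk
      obtain rfl : k = 0 := by omega
      exact hm (by simpa using hpq)
    obtain ⟨hpk, hmo⟩ := Nat.odd_mul.1 hq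
    have hcop : (p ^ k).Coprime m := ((hp.coprime_iff_not_dvd).2 hm).pow_left k
    have hm1 : m = 1 := by
      by_contra hm1
      have hm2 : 2 < m := by
        obtain ⟨r, rfl⟩ := hmo
        omega
      have hp2 : 2 < p ^ k := by
        have := Nat.one_lt_pow (by omega : k ≠ 0) hp.one_lt
        obtain ⟨r, hr⟩ := hpk
        omega
      rw [Nat.totient_mul hcop, padicValNat.mul (Nat.totient_pos.2 (by omega)).ne'
        (Nat.totient_pos.2 (by omega)).ne'] at h
      have := one_le_padicValNat_two_totient hm2
      have := one_le_padicValNat_two_totient hp2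
      omega
    subst hm1
    rw [mul_one] at h ⊢
    exact ⟨p, k, hp, (padicValNat_two_totient_prime_pow_eq_one_iff hp hpo hk).1 h, hk, rfl⟩
  · rintro ⟨p, k, hp, hp4, hk, rfl⟩
    exact (padicValNat_two_totient_prime_pow_eq_one_iff hp (Nat.odd_iff.2 (by omega)) hk).2 hp4

theorem stmt_8 (n ℓ q : ℕ) (hℓ : 1 ≤ ℓ) (hq1 : 1 < q) (hq : Odd q)
    (hn : n = 2 ^ ℓ * q) :
    padicValNat 2 n = ℓ ∧ ℓ ≤ padicValNat 2 (Nat.totient n) ∧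
      (padicValNat 2 (Nat.totient n) = ℓ ↔
        ∃ p α : ℕ, Nat.Prime p ∧ p % 4 = 3 ∧ 1 ≤ α ∧ q = p ^ α) := by
  have hq2 : 2 < q := by
    obtain ⟨r, rfl⟩ := hq
    omega
  have hv : padicValNat 2 n = ℓ := by
    rw [hn, padicValNat.mul (by positivity) (by omega), padicValNat.prime_pow,
      padicValNat.eq_zero_of_not_dvd hq.not_two_dvd_nat, add_zero]
  have hφ : padicValNat 2 n.totient = ℓ - 1 + padicValNat 2 q.totient := by
    rw [hn, Nat.totient_mul ((Nat.coprime_two_left.2 hq).pow_left ℓ),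
      Nat.totient_prime_pow Nat.prime_two hℓ, Nat.add_one_sub_one, mul_one,
      padicValNat.mul (by positivity) (Nat.totient_pos.2 (by omega)).ne', padicValNat.prime_pow]
  have h1 := one_le_padicValNat_two_totient hq2
  refine ⟨hv, by omega, ?_⟩
  rw [← padicValNat_two_totient_eq_one_iff hq1 hq]
  omega
end

section
/- Suppose a positive integer n satisfies φ(n) + φ(n + φ(n)) = n and n + φ(n) = 2^L for some natural number L. Then L ≥ 2 and n = 3·2^{L-2}. -/
theorem stmt_10 (n L : ℕ) (hn : 0 < n)
    (h : Nat.totient n + Nat.totient (n + Nat.totient n) = n)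
    (hL : n + Nat.totient n = 2 ^ L) :
    2 ≤ L ∧ n = 3 * 2 ^ (L - 2) := by
  have hpos := Nat.totient_pos.2 hn
  rw [hL] at h
  match L with
  | 0 => omega
  | 1 => simp at h hL; omega
  | k + 2 =>
    rw [Nat.totient_prime_pow_succ Nat.prime_two] at h
    simp only [Nat.add_sub_cancel, pow_succ] at h hL ⊢
    omega
end

section
/- Let p be a prime with p ≡ 3 (mod 4), let α ≥ 2 and ℓ ≥ 1 be integers. Then n = 2^ℓ·p^α does not satisfy φ(n) + φ(n + φ(n)) = n. -/
theorem Nat.Prime.dvd_totient_of_dvd_totient_two_pow_mul {p : ℕ} (hp : p.Prime) (hp2 : p ≠ 2)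
    {k m : ℕ} (h : p ∣ Nat.totient (2 ^ (k + 1) * m)) : p ∣ Nat.totient m := by
  have hpow (j : ℕ) : ¬ p ∣ 2 ^ j := fun hj =>
    hp2 ((Nat.prime_dvd_prime_iff_eq hp Nat.prime_two).1 (hp.dvd_of_dvd_pow hj))
  have hdvd := h.mul_left (Nat.totient (Nat.gcd (2 ^ (k + 1)) m))
  rw [Nat.totient_gcd_mul_totient_mul, Nat.totient_prime_pow_succ Nat.prime_two] at hdvd
  rcases hp.dvd_mul.1 hdvd with h₁ | h₁
  · exact (hp.dvd_mul.1 h₁).resolve_left (by simpa using hpow k)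
  · exact absurd (h₁.trans (Nat.gcd_dvd_left _ _)) (hpow _)

theorem stmt_14 (p α ℓ : ℕ) (hp : Nat.Prime p) (hp4 : p % 4 = 3)
    (hα : 2 ≤ α) (hℓ : 1 ≤ ℓ) :
    Nat.totient (2 ^ ℓ * p ^ α) +
      Nat.totient (2 ^ ℓ * p ^ α + Nat.totient (2 ^ ℓ * p ^ α)) ≠ 2 ^ ℓ * p ^ α := by
  obtain ⟨a, rfl⟩ := Nat.exists_eq_add_of_le' hα
  obtain ⟨b, rfl⟩ := Nat.exists_eq_add_of_le' hℓ
  obtain ⟨r, hr⟩ : ∃ r, p = 4 * r + 3 := ⟨p / 4, by omega⟩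
  have hp2 : p ≠ 2 := by omega
  have hcop2 : Nat.Coprime p 2 := (Nat.coprime_primes hp Nat.prime_two).2 hp2
  have hq : ¬ p ∣ 3 * r + 2 := fun h => by
    have := Nat.le_of_dvd (by omega) h
    omega
  have hn : Nat.totient (2 ^ (b + 1) * p ^ (a + 2)) = 2 ^ b * (p ^ (a + 1) * (p - 1)) := by
    rw [Nat.totient_mul (hcop2.symm.pow _ _), Nat.totient_prime_pow_succ Nat.prime_two,
      Nat.totient_prime_pow_succ hp]
    simp
  have hsum : 2 ^ (b + 1) * p ^ (a + 2) + 2 ^ b * (p ^ (a + 1) * (p - 1)) =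
      p ^ (a + 1) * (2 ^ (b + 1 + 1) * (3 * r + 2)) := by
    have h₁ : 2 * p + (p - 1) = 4 * (3 * r + 2) := by omega
    calc _ = 2 ^ b * p ^ (a + 1) * (2 * p + (p - 1)) := by ring
      _ = _ := by rw [h₁]; ring
  have hcop : Nat.Coprime (p ^ (a + 1)) (2 ^ (b + 1 + 1) * (3 * r + 2)) :=
    ((hcop2.pow_right _).mul_right (hp.coprime_iff_not_dvd.2 hq)).pow_left _
  rw [hn, hsum, Nat.totient_mul hcop, Nat.totient_prime_pow_succ hp]
  intro h
  have hdvd : p ^ a * p ∣ p ^ a * ((p - 1) * Nat.totient (2 ^ (b + 1 + 1) * (3 * r + 2))) := by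
    rw [← mul_assoc, ← Nat.dvd_add_right (b := 2 ^ b * (p ^ (a + 1) * (p - 1))), h]
    · exact ⟨2 ^ (b + 1) * p, by ring⟩
    · exact ⟨2 ^ b * (p - 1), by ring⟩
  rcases hp.dvd_mul.1 (Nat.dvd_of_mul_dvd_mul_left (pow_pos hp.pos a) hdvd) with h₁ | h₁
  · have := Nat.le_of_dvd (by omega) h₁
    omega
  · have h₂ := Nat.le_of_dvd (Nat.totient_pos.2 (by omega))
      (hp.dvd_totient_of_dvd_totient_two_pow_mul hp2 h₁)
    have := Nat.totient_le (3 * r + 2)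
    omega
end

section
/- Let ℓ ≥ 1 and let p > 3 be a prime with p ≡ 3 (mod 4), and suppose n = 2^ℓ·p satisfies φ(n) + φ(n + φ(n)) = n. Then there exists an odd integer q with 3p − 1 = 4q and 3·φ(q) = 2·(q+1). -/
theorem totient_two_pow_mul_of_even {q : ℕ} (hq : Even q) (j : ℕ) :
    Nat.totient (2 ^ j * q) = 2 ^ j * Nat.totient q := by
  induction j with
  | zero => simp
  | succ j ih =>
    rw [pow_succ', mul_assoc, Nat.totient_mul_of_prime_of_dvd Nat.prime_two
      (dvd_mul_of_dvd_right hq.two_dvd _), ih, mul_assoc]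

theorem totient_two_pow_succ_mul_of_odd {q : ℕ} (hq : Odd q) (j : ℕ) :
    Nat.totient (2 ^ (j + 1) * q) = 2 ^ j * Nat.totient q := by
  rw [Nat.totient_mul ((Nat.coprime_two_left.2 hq).pow_left _),
    Nat.totient_prime_pow_succ Nat.prime_two, Nat.add_one_sub_one, mul_one]

theorem stmt_15 (p ℓ : ℕ) (hℓ : 1 ≤ ℓ) (hp : Nat.Prime p) (hp3 : 3 < p)
    (hp4 : p % 4 = 3)
    (h : Nat.totient (2 ^ ℓ * p) +
      Nat.totient (2 ^ ℓ * p + Nat.totient (2 ^ ℓ * p)) = 2 ^ ℓ * p) :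
    ∃ q : ℕ, Odd q ∧ 3 * p - 1 = 4 * q ∧ 3 * Nat.totient q = 2 * (q + 1) := by
  obtain ⟨j, rfl⟩ : ∃ j, ℓ = j + 1 := ⟨ℓ - 1, by omega⟩
  obtain ⟨k, rfl⟩ : ∃ k, p = 4 * k + 3 := ⟨p / 4, by omega⟩
  have hn : Nat.totient (2 ^ (j + 1) * (4 * k + 3)) = 2 ^ j * (4 * k + 2) := by
    rw [totient_two_pow_succ_mul_of_odd ⟨2 * k + 1, by ring⟩, Nat.totient_prime hp]
    rfl
  have hsum : 2 ^ (j + 1) * (4 * k + 3) + 2 ^ j * (4 * k + 2) =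
      2 ^ (j + 2) * (3 * k + 2) := by ring
  rw [hn, hsum] at h
  have hpos : 0 < 2 ^ j := by positivity
  rcases Nat.even_or_odd (3 * k + 2) with hq | hq
  · rw [totient_two_pow_mul_of_even hq] at h
    have hφ : Nat.totient (3 * k + 2) = k + 1 := by
      apply Nat.eq_of_mul_eq_mul_left hpos
      simp only [pow_succ] at h
      linarith
    have heven := Nat.totient_even (n := 3 * k + 2) (by omega)
    rw [hφ] at heven
    grind
  · refine ⟨3 * k + 2, hq, by omega, ?_⟩
    rw [totient_two_pow_succ_mul_of_odd hq] at h
    have hφ : Nat.totient (3 * k + 2) = 2 * k + 2 := by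
      apply Nat.eq_of_mul_eq_mul_left hpos
      rw [pow_succ] at h
      linarith
    rw [hφ]
    ring
end

section
/- If m is a natural number such that 8m+7 < 10^10, 8m+7 is prime, and φ(6m+5) = 4m+4, then m = 0 or m = 5 (i.e., the prime 8m+7 is 7 or 47). -/
/-- A prime dividing `n` twice divides both `n` and `φ n`, hence, by `3 * φ n = 2 * (n + 1)`, it
divides `2`. -/
theorem squarefree_of_three_mul_totient_s19 {n : ℕ} (hn : Odd n)
    (h : 3 * n.totient = 2 * (n + 1)) : Squarefree n := by
  rw [Nat.squarefree_iff_prime_squarefree]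
  rintro p hp ⟨c, rfl⟩
  have hφ : p ∣ (p * p * c).totient := by
    rw [mul_assoc, Nat.totient_mul_of_prime_of_dvd hp (dvd_mul_right p c)]
    exact dvd_mul_right _ _
  have h1 : p ∣ 2 * (p * p * c) + 2 := by
    have := Dvd.dvd.mul_left hφ 3
    rwa [h, mul_add, mul_one] at this
  have hdvd : p ∣ p * p * c := by rw [mul_assoc]; exact dvd_mul_right _ _
  have h2 : p ∣ 2 := (Nat.dvd_add_right (hdvd.mul_left 2)).1 h1
  rw [Nat.prime_dvd_prime_iff_eq hp Nat.prime_two] at h2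
  subst h2
  exact (Nat.not_even_iff_odd.2 hn) (even_iff_two_dvd.2 hdvd)

theorem totient_eq_prod_of_squarefree {n : ℕ} (hn : Squarefree n) :
    n.totient = ∏ q ∈ n.primeFactors, (q - 1) := by
  have h := Nat.totient_mul_prod_primeFactors n
  rw [Nat.prod_primeFactors_of_squarefree hn, mul_comm] at h
  exact Nat.eq_of_mul_eq_mul_left (Nat.pos_of_ne_zero hn.ne_zero) h

theorem pow_card_primeFactors_le {n p : ℕ} (hn : Squarefree n)
    (hp : ∀ q ∈ n.primeFactors, p ≤ q) : p ^ n.primeFactors.card ≤ n := by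
  conv_rhs => rw [← Nat.prod_primeFactors_of_squarefree hn]
  exact Finset.pow_card_le_prod _ _ _ hp

theorem mul_pred_pow_le_totient_mul_pow {n p : ℕ} (hn : Squarefree n)
    (hp : ∀ q ∈ n.primeFactors, p ≤ q) :
    n * (p - 1) ^ n.primeFactors.card ≤ n.totient * p ^ n.primeFactors.card := by
  rw [totient_eq_prod_of_squarefree hn]
  conv_lhs => enter [1]; rw [← Nat.prod_primeFactors_of_squarefree hn]
  rw [← Finset.prod_const, ← Finset.prod_const, ← Finset.prod_mul_distrib,
    ← Finset.prod_mul_distrib]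
  refine Finset.prod_le_prod' fun q hq => ?_
  have := hp q hq
  rw [Nat.mul_sub, Nat.sub_mul, mul_one, one_mul]
  exact Nat.sub_le_sub_left this _

/-- `searchCheck X S fuel r a b p` certifies that every `a * n ≤ X`, with `n` a product of `r`
distinct primes at least `p` and coprime to `6` satisfying `3 * b * φ n = 2 * (a * n + 1)`,
belongs to `S`. -/
def searchCheck (X : ℕ) (S : List ℕ) : ℕ → ℕ → ℕ → ℕ → ℕ → Bool
  | 0, _, _, _, _ => false
  | _ + 1, 0, _, _, _ => false
  | _ + 1, 1, a, b, p =>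
    Nat.blt 0 ((3 * b + 2) % (3 * b - 2 * a)) ||
      (Nat.blt ((3 * b + 2) / (3 * b - 2 * a)) p ||
        (Nat.blt X (a * ((3 * b + 2) / (3 * b - 2 * a))) ||
          S.elem (a * ((3 * b + 2) / (3 * b - 2 * a)))))
  | fuel + 1, r + 2, a, b, p =>
    Nat.ble (3 * b) (2 * a) ||
      (Nat.blt X (a * p ^ (r + 2)) ||
        (Nat.blt (2 * a * p ^ (r + 2) + 2) (3 * b * (p - 1) ^ (r + 2)) ||
          ((Nat.blt 1 (Nat.gcd p 6) || searchCheck X S fuel (r + 1) (a * p) (b * (p - 1)) (p + 1)) &&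
            searchCheck X S fuel (r + 2) a b (p + 1))))

theorem mem_of_searchCheck {X : ℕ} {S : List ℕ} {fuel r a b p n : ℕ}
    (hs : searchCheck X S fuel r a b p = true) (hn : Squarefree n) (h6 : n.Coprime 6)
    (hr : n.primeFactors.card = r) (hp : ∀ q ∈ n.primeFactors, p ≤ q) (hX : a * n ≤ X)
    (h : 3 * b * n.totient = 2 * (a * n + 1)) : a * n ∈ S := by
  induction fuel generalizing r a b p n with
  | zero => simp [searchCheck] at hs
  | succ fuel ih =>
    have hn0 : 0 < n := Nat.pos_of_ne_zero hn.ne_zero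
    match r with
    | 0 => simp [searchCheck] at hs
    | 1 =>
      obtain ⟨q, hq⟩ := Finset.card_eq_one.1 hr
      have hqn : n = q := by
        rw [← Nat.prod_primeFactors_of_squarefree hn, hq, Finset.prod_singleton]
      have hqp : q.Prime := Nat.prime_of_mem_primeFactors (n := n) (by simp [hq])
      have hpq : p ≤ q := hp q (by simp [hq])
      subst hqn
      rw [Nat.totient_prime hqp] at h
      have hD : 3 * b + 2 = n * (3 * b - 2 * a) := by
        obtain ⟨k, rfl⟩ : ∃ k, n = k + 1 := ⟨n - 1, by omega⟩
        simp only [Nat.add_sub_cancel] at h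
        have : 2 * a ≤ 3 * b := by nlinarith
        zify [this]
        zify at h
        linarith
      have hD0 : 0 < 3 * b - 2 * a := by
        rcases Nat.eq_zero_or_pos (3 * b - 2 * a) with h0 | h0
        · rw [h0] at hD; omega
        · exact h0
      have hdiv : (3 * b + 2) / (3 * b - 2 * a) = n := by
        rw [hD, Nat.mul_div_cancel _ hD0]
      have hmod : (3 * b + 2) % (3 * b - 2 * a) = 0 := by
        rw [hD, Nat.mul_mod_left]
      simp only [searchCheck, hdiv, hmod, Nat.blt_eq, Bool.or_eq_true, List.elem_eq_mem,
        decide_eq_true_eq] at hs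
      rcases hs with hs | hs | hs | hs
      · omega
      · omega
      · omega
      · exact hs
    | r + 2 =>
      have hpow := pow_card_primeFactors_le hn hp
      have hdens := mul_pred_pow_le_totient_mul_pow hn hp
      rw [hr] at hpow hdens
      simp only [searchCheck, Bool.or_eq_true, Bool.and_eq_true, Nat.ble_eq, Nat.blt_eq] at hs
      rcases hs with hs | hs | hs | ⟨hs, hs'⟩
      · have := Nat.totient_le n
        have := Nat.mul_le_mul hs this
        nlinarith
      · have := Nat.mul_le_mul_left a hpow
        omega
      · have h1 := Nat.mul_le_mul_left (3 * b) hdens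
        have h2 := Nat.mul_lt_mul_of_pos_left hs hn0
        have h3 : 3 * b * (n.totient * p ^ (r + 2)) = 2 * (a * n + 1) * p ^ (r + 2) := by
          rw [← h]; ring
        nlinarith
      · by_cases hpn : p ∈ n.primeFactors
        · have hpp := Nat.prime_of_mem_primeFactors hpn
          obtain ⟨k, rfl⟩ := Nat.dvd_of_mem_primeFactors hpn
          have hcop : p.Coprime k := Nat.coprime_of_squarefree_mul hn
          have hk := hn.of_mul_right
          have hfac : (p * k).primeFactors = insert p k.primeFactors := by
            rw [hcop.primeFactors_mul, hpp.primeFactors, Finset.singleton_union]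
          have hpk : p ∉ k.primeFactors := fun hmem =>
            (hpp.coprime_iff_not_dvd.1 hcop) (Nat.dvd_of_mem_primeFactors hmem)
          rw [hfac, Finset.card_insert_of_notMem hpk] at hr
          have h6p : Nat.gcd p 6 = 1 := Nat.Coprime.coprime_mul_right h6
          rw [← mul_assoc] at hX ⊢
          refine ih (hs.resolve_left (by omega)) hk (Nat.Coprime.coprime_mul_left h6)
            (by omega) (fun q hq => ?_) hX ?_
          · have := hp q (by rw [hfac]; exact Finset.mem_insert_of_mem hq)
            have : q ≠ p := fun e => hpk (e ▸ hq)
            omega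
          · rw [Nat.totient_mul hcop, Nat.totient_prime hpp] at h
            rw [mul_assoc a, ← h]
            ring
        · refine ih hs' hn h6 hr (fun q hq => ?_) hX h
          have := hp q hq
          have : q ≠ p := fun e => hpn (e ▸ hq)
          omega

theorem mem_of_three_mul_totient {n : ℕ} (hX : n ≤ 7500000000) (h1 : n ≠ 1)
    (h6 : n.Coprime 6) (h : 3 * n.totient = 2 * (n + 1)) :
    n ∈ [5, 35, 1295, 1679615, 228095, 3024288575, 192494015] := by
  have hodd : Odd n := (Nat.Coprime.coprime_dvd_right (by norm_num) h6).odd_of_right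
  have hsq := squarefree_of_three_mul_totient_s19 hodd h
  have hp : ∀ q ∈ n.primeFactors, 5 ≤ q := by
    intro q hq
    have hqp := Nat.prime_of_mem_primeFactors hq
    have hq6 : q.Coprime 6 := Nat.Coprime.coprime_dvd_left (Nat.dvd_of_mem_primeFactors hq) h6
    have := hqp.two_le
    by_contra! hlt
    interval_cases q <;> revert hq6 <;> decide
  have hcard : n.primeFactors.card < 15 := by
    by_contra! hge
    have := pow_card_primeFactors_le hsq hp
    have := Nat.pow_le_pow_right (show 0 < 5 by norm_num) hge
    omega
  have hpos : n.primeFactors.card ≠ 0 := by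
    rw [Finset.card_ne_zero, Nat.nonempty_primeFactors]
    exact Nat.one_lt_iff_ne_zero_and_ne_one.2 ⟨hsq.ne_zero, h1⟩
  have hs : ∀ r < 15, r ≠ 0 → searchCheck 7500000000
      [5, 35, 1295, 1679615, 228095, 3024288575, 192494015] 3000 r 1 1 5 = true := by
    decide +kernel
  have := mem_of_searchCheck (hs _ hcard hpos) hsq h6 rfl hp (by omega) (by omega)
  rwa [one_mul] at this

theorem stmt_19 (m : ℕ) (hlt : 8 * m + 7 < 10 ^ 10)
    (hp : Nat.Prime (8 * m + 7)) (hφ : Nat.totient (6 * m + 5) = 4 * m + 4) :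
    m = 0 ∨ m = 5 := by
  have h6 : (6 * m + 5).Coprime 6 := by simp [Nat.Coprime]
  have hφ' : 3 * (6 * m + 5).totient = 2 * (6 * m + 5 + 1) := by omega
  have hsq := squarefree_of_three_mul_totient_s19 ⟨3 * m + 2, by ring⟩ hφ'
  have hmem := mem_of_three_mul_totient (by omega) (by omega) h6 hφ'
  simp only [List.mem_cons, List.not_mem_nil, or_false] at hmem
  rcases hmem with h | h | h | h | h | h | h
  · omega
  · omega
  · obtain rfl : m = 215 := by omega
    norm_num at hp
  · obtain rfl : m = 279935 := by omega
    norm_num at hp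
  · rw [h] at hsq
    have := hsq 7 (by norm_num)
    simp at this
  · rw [h] at hsq
    have := hsq 5 (by norm_num)
    simp at this
  · obtain rfl : m = 32082335 := by omega
    norm_num at hp
end
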